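/- arXiv:0709.0738 — 7 statements merged into one kernel-verified Lean document; each statement's English description precedes it below -/
import Mathlib

section
/- Let n be a positive natural number and let ψ, φ : Fin n × Fin 3 → ℂ be unit vectors in the ℓ² norm. If there exist k : Fin n and l : Fin 3 such that |‖ψ (k,l)‖² − ‖φ (k,l)‖²| ≥ 1/n³, then ‖∑ p, conj (ψ p) * φ p‖² ≤ 1 − 1/(4*n⁶); consequently the swap-test failure probability (1 − ‖∑ p, conj (ψ p) * φ p‖²)/2 is at least 1/(8*n⁶). -/
/-- Two unit vectors whose outcome probabilities at `i` differ by `d` have squared overlap at most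
`1 - d ^ 2`. -/
theorem norm_sum_conj_mul_sq_le {ι : Type*} [Fintype ι] (ψ φ : ι → ℂ)
    (hψ : ∑ p, ‖ψ p‖ ^ 2 = 1) (hφ : ∑ p, ‖φ p‖ ^ 2 = 1) (i : ι) :
    ‖∑ p, (starRingEnd ℂ) (ψ p) * φ p‖ ^ 2 ≤ 1 - (‖ψ i‖ ^ 2 - ‖φ i‖ ^ 2) ^ 2 := by
  classical
  have hN : ‖∑ p, (starRingEnd ℂ) (ψ p) * φ p‖ ≤ ∑ p, ‖ψ p‖ * ‖φ p‖ :=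
    (norm_sum_le _ _).trans_eq (by simp)
  rw [← Finset.add_sum_erase _ (fun p ↦ ‖ψ p‖ * ‖φ p‖) (Finset.mem_univ i)] at hN
  have hCS := Finset.sum_mul_sq_le_sq_mul_sq (Finset.univ.erase i) (‖ψ ·‖) (‖φ ·‖)
  rw [← Finset.add_sum_erase _ _ (Finset.mem_univ i)] at hψ hφ
  have hA : 0 ≤ ∑ p ∈ Finset.univ.erase i, ‖ψ p‖ ^ 2 := by positivity
  have hB : 0 ≤ ∑ p ∈ Finset.univ.erase i, ‖φ p‖ ^ 2 := by positivity
  rw [← Real.sq_sqrt hA] at hψ hCS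
  rw [← Real.sq_sqrt hB, ← mul_pow] at hCS
  rw [← Real.sq_sqrt hB] at hφ
  have hst := le_of_abs_le (abs_le_of_sq_le_sq hCS (by positivity))
  set s := √(∑ p ∈ Finset.univ.erase i, ‖ψ p‖ ^ 2)
  set t := √(∑ p ∈ Finset.univ.erase i, ‖φ p‖ ^ 2)
  set a := ‖ψ i‖
  set b := ‖φ i‖
  have hle : ‖∑ p, (starRingEnd ℂ) (ψ p) * φ p‖ ^ 2 ≤ (a * b + s * t) ^ 2 := by
    gcongr
    linarith
  have hprod : (a ^ 2 + s ^ 2) * (b ^ 2 + t ^ 2) = 1 := by rw [hψ, hφ, one_mul]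
  have hdiff : a ^ 2 - b ^ 2 = (a * t - b * s) * (a * t + b * s) := by
    linear_combination b ^ 2 * hψ - a ^ 2 * hφ
  have hsum : (a * t + b * s) ^ 2 ≤ 1 := by nlinarith [sq_nonneg (a * b - s * t)]
  have hsq : (a ^ 2 - b ^ 2) ^ 2 ≤ (a * t - b * s) ^ 2 := by
    rw [hdiff, mul_pow]
    exact mul_le_of_le_one_right (sq_nonneg _) hsum
  linarith [show (a * b + s * t) ^ 2 + (a * t - b * s) ^ 2 = 1 by linear_combination hprod]

/-- Lemma 3 (`lemma1`) of the paper: if the computational-basis outcome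
probabilities of the two unit-vector registers `ψ, φ : Fin n × Fin 3 → ℂ`
differ by at least `1/n³` at some outcome `(k, l)`, then
`|⟨ψ|φ⟩|² ≤ 1 − 1/(4n⁶)`, so the swap test fails with probability at
least `1/(8n⁶)`. -/
theorem swap_test_fails (n : ℕ) (hn : 0 < n)
    (ψ φ : Fin n × Fin 3 → ℂ)
    (hψ : ∑ p, ‖ψ p‖ ^ 2 = 1) (hφ : ∑ p, ‖φ p‖ ^ 2 = 1)
    (h : ∃ (k : Fin n) (l : Fin 3),
      |‖ψ (k, l)‖ ^ 2 - ‖φ (k, l)‖ ^ 2| ≥ 1 / (n : ℝ) ^ 3) :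
    ‖∑ p, (starRingEnd ℂ) (ψ p) * φ p‖ ^ 2 ≤ 1 - 1 / (4 * (n : ℝ) ^ 6) ∧
      (1 - ‖∑ p, (starRingEnd ℂ) (ψ p) * φ p‖ ^ 2) / 2 ≥ 1 / (8 * (n : ℝ) ^ 6) := by
  obtain ⟨k, l, hkl⟩ := h
  have hover := norm_sum_conj_mul_sq_le ψ φ hψ hφ (k, l)
  have hgap : (1 / (n : ℝ) ^ 3) ^ 2 ≤ (‖ψ (k, l)‖ ^ 2 - ‖φ (k, l)‖ ^ 2) ^ 2 := by
    rw [← sq_abs (‖ψ (k, l)‖ ^ 2 - _)]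
    gcongr
  have hpow : (1 / (n : ℝ) ^ 3) ^ 2 = 1 / (n : ℝ) ^ 6 := by rw [div_pow, one_pow, ← pow_mul]
  have hpos : 0 ≤ 1 / (n : ℝ) ^ 6 := by positivity
  have hfour : 1 / (4 * (n : ℝ) ^ 6) = 1 / (n : ℝ) ^ 6 / 4 := by ring
  have height : 1 / (8 * (n : ℝ) ^ 6) = 1 / (n : ℝ) ^ 6 / 8 := by ring
  constructor <;> linarith
end

section
/- There exists N : ℕ such that for all n ≥ N the following holds. Let α, α' : Fin n → ℂ and β, β' : Fin n → Fin 3 → ℂ satisfy ∑ i, ‖α i‖² = 1, ∑ i, ‖α' i‖² = 1, and for every i, ∑ j, ‖β i j‖² = 1 and ∑ j, ‖β' i j‖² = 1. Define ψ (i,j) = α i * β i j and φ (i,j) = α' i * β' i j. Assume (Test 1) the swap-test failure probability satisfies (1 − ‖∑ p, conj (ψ p) * φ p‖²)/2 ≤ 1/(8*n⁶), and (Test 2a) ∑ i, ∑ over pairs j ≠ j', ‖ψ (i,j)‖² * ‖φ (i,j')‖² ≤ 1/(8*n⁶). Then for every i with ‖α i‖² ≥ 1/n², there exists a unique j : Fin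 3 with ‖β i j‖² ≥ 99/100. -/
/-- The moduli of two unit vectors differ in squared `ℓ²` distance by at most the swap-test
deficit `1 - ‖⟨ψ, φ⟩‖ ^ 2`, up to a factor `2`. -/
lemma sum_sq_norm_sub_norm_le {ι : Type*} [Fintype ι] (ψ φ : ι → ℂ)
    (hψ : ∑ p, ‖ψ p‖ ^ 2 = 1) (hφ : ∑ p, ‖φ p‖ ^ 2 = 1) :
    ∑ p, (‖ψ p‖ - ‖φ p‖) ^ 2 ≤ 2 * (1 - ‖∑ p, (starRingEnd ℂ) (ψ p) * φ p‖ ^ 2) := by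
  have hle : ‖∑ p, (starRingEnd ℂ) (ψ p) * φ p‖ ≤ ∑ p, ‖ψ p‖ * ‖φ p‖ :=
    (norm_sum_le _ _).trans_eq (by simp)
  have hexp : ∑ p, (‖ψ p‖ - ‖φ p‖) ^ 2 = 2 - 2 * ∑ p, ‖ψ p‖ * ‖φ p‖ := by
    have h : ∀ p, (‖ψ p‖ - ‖φ p‖) ^ 2 = ‖ψ p‖ ^ 2 + ‖φ p‖ ^ 2 - 2 * (‖ψ p‖ * ‖φ p‖) :=
      fun p => by ring
    simp_rw [h]
    rw [Finset.sum_sub_distrib, Finset.sum_add_distrib, ← Finset.mul_sum, hψ, hφ]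
    ring
  have hnn : 0 ≤ ∑ p, (‖ψ p‖ - ‖φ p‖) ^ 2 := Finset.sum_nonneg fun p _ => sq_nonneg _
  have h0 := norm_nonneg (∑ p, (starRingEnd ℂ) (ψ p) * φ p)
  rw [hexp] at hnn ⊢
  nlinarith

lemma sum_sq_norm_mul_eq_one {ι κ : Type*} [Fintype ι] [Fintype κ] (α : ι → ℂ) (β : ι → κ → ℂ)
    (ψ : ι × κ → ℂ) (hα : ∑ i, ‖α i‖ ^ 2 = 1) (hβ : ∀ i, ∑ j, ‖β i j‖ ^ 2 = 1)
    (hψ : ∀ i j, ψ (i, j) = α i * β i j) : ∑ p, ‖ψ p‖ ^ 2 = 1 := by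
  simp_rw [Fintype.sum_prod_type, hψ, norm_mul, mul_pow, ← Finset.mul_sum, hβ, mul_one, hα]

/-- A distribution on three points without a dominant atom has two non-negligible atoms. -/
lemma exists_ne_ge_of_forall_lt (t : Fin 3 → ℝ) (h : ∑ j, t j = 1)
    (hlt : ∀ j, t j < 99 / 100) : ∃ j j', j ≠ j' ∧ 1 / 200 ≤ t j ∧ 1 / 200 ≤ t j' := by
  rw [Fin.sum_univ_three] at h
  have h0 := hlt 0
  have h1 := hlt 1
  have h2 := hlt 2
  by_cases c0 : 1 / 200 ≤ t 0
  · by_cases c1 : 1 / 200 ≤ t 1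
    · exact ⟨0, 1, by decide, c0, c1⟩
    · exact ⟨0, 2, by decide, c0, by linarith⟩
  · exact ⟨1, 2, by decide, by linarith, by linarith⟩

/-- Lemma 4 (`lemma2`) of the paper: for large enough `n`, if the product-state
proofs `ψ (i,j) = α i * β i j` and `φ (i,j) = α' i * β' i j` pass Test 1
(swap test) and part a) of Test 2 (consistency of the colors on equal nodes)
with failure probability at most `1/(8n⁶)`, then every node `i` observed with
probability at least `1/n²` has a unique well-defined color `j` with
`‖β i j‖² ≥ 99/100`. -/
theorem nodes_have_well_defined_color :
    ∃ N : ℕ, ∀ n : ℕ, n ≥ N →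
      ∀ (α α' : Fin n → ℂ) (β β' : Fin n → Fin 3 → ℂ),
      (∑ i, ‖α i‖ ^ 2 = 1) → (∑ i, ‖α' i‖ ^ 2 = 1) →
      (∀ i, ∑ j, ‖β i j‖ ^ 2 = 1) → (∀ i, ∑ j, ‖β' i j‖ ^ 2 = 1) →
      ∀ (ψ φ : Fin n × Fin 3 → ℂ),
      (∀ i j, ψ (i, j) = α i * β i j) → (∀ i j, φ (i, j) = α' i * β' i j) →
      (1 - ‖∑ p, (starRingEnd ℂ) (ψ p) * φ p‖ ^ 2) / 2 ≤ 1 / (8 * (n : ℝ) ^ 6) →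
      (∑ i : Fin n, ∑ j : Fin 3, ∑ j' : Fin 3,
          if j ≠ j' then ‖ψ (i, j)‖ ^ 2 * ‖φ (i, j')‖ ^ 2 else 0)
        ≤ 1 / (8 * (n : ℝ) ^ 6) →
      ∀ i : Fin n, ‖α i‖ ^ 2 ≥ 1 / (n : ℝ) ^ 2 →
        ∃! j : Fin 3, ‖β i j‖ ^ 2 ≥ 99 / 100 := by
  refine ⟨200, fun n hn α α' β β' hα hα' hβ hβ' ψ φ hψ hφ hswap hcol i hi => ?_⟩
  have hn' : (200 : ℝ) ≤ n := by exact_mod_cast hn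
  obtain ⟨y, hy⟩ : ∃ y : ℝ, y = 1 / (n : ℝ) ^ 2 := ⟨_, rfl⟩
  have hy0 : 0 < y := by rw [hy]; positivity
  have hy1 : y ≤ 1 / 40000 := by
    rw [hy]
    exact one_div_le_one_div_of_le (by norm_num) (by nlinarith)
  have hy3 : 1 / (8 * (n : ℝ) ^ 6) = y ^ 3 / 8 := by
    rw [hy]
    field_simp
  rw [hy3] at hswap hcol
  rw [← hy] at hi
  have hdist := sum_sq_norm_sub_norm_le ψ φ (sum_sq_norm_mul_eq_one α β ψ hα hβ hψ)
    (sum_sq_norm_mul_eq_one α' β' φ hα' hβ' hφ)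
  have hex : ∃ j : Fin 3, ‖β i j‖ ^ 2 ≥ 99 / 100 := by
    by_contra! hlt
    obtain ⟨j, j', hne, hj, hj'⟩ := exists_ne_ge_of_forall_lt _ (hβ i) hlt
    have hψ_ge : ∀ k, 1 / 200 ≤ ‖β i k‖ ^ 2 → y / 200 ≤ ‖ψ (i, k)‖ ^ 2 := fun k hk => by
      rw [hψ, norm_mul, mul_pow]
      nlinarith
    have hclose : (‖ψ (i, j')‖ - ‖φ (i, j')‖) ^ 2 ≤ y ^ 3 / 2 := by
      have := Finset.single_le_sum (f := fun p => (‖ψ p‖ - ‖φ p‖) ^ 2)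
        (fun p _ => sq_nonneg _) (Finset.mem_univ (i, j'))
      linarith
    have hy2 : y ^ 2 ≤ 1 / 40000 * y := by nlinarith
    have hy3' : y ^ 3 ≤ 1 / 40000 * y ^ 2 := by nlinarith [sq_nonneg y]
    have hφ_ge : y / 800 ≤ ‖φ (i, j')‖ ^ 2 := by
      have := hψ_ge j' hj'
      nlinarith [sq_nonneg (‖ψ (i, j')‖ - 2 * ‖φ (i, j')‖)]
    have hmul : y / 200 * (y / 800) ≤ ‖ψ (i, j)‖ ^ 2 * ‖φ (i, j')‖ ^ 2 :=
      mul_le_mul (hψ_ge j hj) hφ_ge (by positivity) (by positivity)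
    have hterm : ‖ψ (i, j)‖ ^ 2 * ‖φ (i, j')‖ ^ 2 ≤ y ^ 3 / 8 := by
      refine le_trans ?_ hcol
      have hnn : ∀ (a : Fin n) (b c : Fin 3),
          0 ≤ if b ≠ c then ‖ψ (a, b)‖ ^ 2 * ‖φ (a, c)‖ ^ 2 else 0 := fun a b c => by
        split_ifs <;> positivity
      calc ‖ψ (i, j)‖ ^ 2 * ‖φ (i, j')‖ ^ 2
          = if j ≠ j' then ‖ψ (i, j)‖ ^ 2 * ‖φ (i, j')‖ ^ 2 else 0 := (if_pos hne).symm
        _ ≤ ∑ c, if j ≠ c then ‖ψ (i, j)‖ ^ 2 * ‖φ (i, c)‖ ^ 2 else 0 :=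
          Finset.single_le_sum (f := fun c => if j ≠ c then ‖ψ (i, j)‖ ^ 2 * ‖φ (i, c)‖ ^ 2 else 0)
            (fun c _ => hnn i j c) (Finset.mem_univ j')
        _ ≤ ∑ b, ∑ c, if b ≠ c then ‖ψ (i, b)‖ ^ 2 * ‖φ (i, c)‖ ^ 2 else 0 :=
          Finset.single_le_sum
            (f := fun b => ∑ c, if b ≠ c then ‖ψ (i, b)‖ ^ 2 * ‖φ (i, c)‖ ^ 2 else 0)
            (fun b _ => Finset.sum_nonneg fun c _ => hnn i b c) (Finset.mem_univ j)
        _ ≤ _ :=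
          Finset.single_le_sum
            (f := fun a => ∑ b, ∑ c, if b ≠ c then ‖ψ (a, b)‖ ^ 2 * ‖φ (a, c)‖ ^ 2 else 0)
            (fun a _ => Finset.sum_nonneg fun b _ => Finset.sum_nonneg fun c _ => hnn a b c)
            (Finset.mem_univ i)
    nlinarith [pow_pos hy0 2]
  obtain ⟨j, hj⟩ := hex
  refine ⟨j, hj, fun k hk => ?_⟩
  by_contra hne
  have hpair := Finset.sum_le_sum_of_subset_of_nonneg (f := fun l => ‖β i l‖ ^ 2)
    (Finset.subset_univ {k, j}) fun l _ _ => sq_nonneg _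
  rw [Finset.sum_pair hne, hβ i] at hpair
  linarith
end

section
/- Let β₀, β₁, β₂ : ℂ satisfy ‖β₀‖² + ‖β₁‖² + ‖β₂‖² = 1 and ‖β₀‖² ≥ 99/100. Then (1/3) * ‖β₀ + β₁ + β₂‖² ≥ 6/25. -/
/-- Key inequality in the proof of Lemma 5 (`lemma3`): if the normalized color
amplitudes `β₀, β₁, β₂` satisfy `‖β₀‖² ≥ 99/100`, then the probability
`(1/3)‖β₀ + β₁ + β₂‖²` of the Fourier outcome `F₃|0⟩` is at least `6/25`. -/
theorem fourier_zero_outcome_prob (β₀ β₁ β₂ : ℂ)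
    (hnorm : ‖β₀‖ ^ 2 + ‖β₁‖ ^ 2 + ‖β₂‖ ^ 2 = 1)
    (h₀ : ‖β₀‖ ^ 2 ≥ 99 / 100) :
    (1 / 3) * ‖β₀ + β₁ + β₂‖ ^ 2 ≥ 6 / 25 := by
  have hβ₀ : 0.9949 ≤ ‖β₀‖ :=
    le_of_pow_le_pow_left₀ two_ne_zero (norm_nonneg _) (by norm_num; linarith)
  have hβ₁₂ : ‖β₁‖ + ‖β₂‖ ≤ 0.1415 :=
    le_of_pow_le_pow_left₀ two_ne_zero (by norm_num) (by nlinarith [sq_nonneg (‖β₁‖ - ‖β₂‖)])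
  have htri : ‖β₀‖ ≤ ‖β₀ + β₁ + β₂‖ + (‖β₁‖ + ‖β₂‖) := by
    have h := norm_sub_le (β₀ + β₁ + β₂) (β₁ + β₂)
    rw [add_assoc, add_sub_cancel_right, ← add_assoc] at h
    linarith [norm_add_le β₁ β₂]
  have hsum : 0.8534 ≤ ‖β₀ + β₁ + β₂‖ := by linarith
  nlinarith
end

section
/- Let n ≥ 6 be a natural number, let α : Fin n → ℂ satisfy ∑ i, ‖α i‖² = 1, and let β : Fin n → Fin 3 → ℂ satisfy ∑ j, ‖β i j‖² = 1 for every i. Assume that for every i with ‖α i‖² ≥ 1/n² there exists j : Fin 3 with ‖β i j‖² ≥ 99/100. Then ∑ i, ‖α i‖² * (1/3) * ‖β i 0 + β i 1 + β i 2‖² ≥ 1/5. -/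
/-- A unit vector of three amplitudes, one of which has squared norm at least `99/100`,
has amplitudes summing to a number of squared norm at least `18/25`. -/
theorem norm_add_add_sq_ge {E : Type*} [SeminormedAddCommGroup E] {x y z : E}
    (h : ‖x‖ ^ 2 + ‖y‖ ^ 2 + ‖z‖ ^ 2 = 1) (hx : 99 / 100 ≤ ‖x‖ ^ 2) :
    18 / 25 ≤ ‖x + y + z‖ ^ 2 := by
  have hx' : 994 / 1000 ≤ ‖x‖ := by nlinarith [norm_nonneg x]
  have hyz : ‖y‖ + ‖z‖ ≤ 142 / 1000 :=
    abs_le_of_sq_le_sq' (by nlinarith [sq_nonneg (‖y‖ - ‖z‖)]) (by norm_num) |>.2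
  have htri : ‖x‖ ≤ ‖x + y + z‖ + (‖y‖ + ‖z‖) := by
    calc ‖x‖ = ‖x + y + z - (y + z)‖ := by congr 1; abel
      _ ≤ ‖x + y + z‖ + ‖y + z‖ := norm_sub_le _ _
      _ ≤ ‖x + y + z‖ + (‖y‖ + ‖z‖) := by gcongr; exact norm_add_le y z
  nlinarith

/-- Lemma 5 (`lemma3`) of the paper: if every node observed with probability at
least `1/n²` has a well-defined color, then the probability of obtaining the
outcome `F₃|0⟩` when the color register of the product state
`ψ (i,j) = α i * β i j` is measured in the Fourier basis is at least `1/5`. -/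
theorem color_fourier_zero_prob (n : ℕ) (hn : n ≥ 6)
    (α : Fin n → ℂ) (β : Fin n → Fin 3 → ℂ)
    (hα : ∑ i, ‖α i‖ ^ 2 = 1) (hβ : ∀ i, ∑ j, ‖β i j‖ ^ 2 = 1)
    (hcolor : ∀ i : Fin n, ‖α i‖ ^ 2 ≥ 1 / (n : ℝ) ^ 2 →
      ∃ j : Fin 3, ‖β i j‖ ^ 2 ≥ 99 / 100) :
    ∑ i, ‖α i‖ ^ 2 * (1 / 3) * ‖β i 0 + β i 1 + β i 2‖ ^ 2 ≥ 1 / 5 := by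
  have hn' : (6 : ℝ) ≤ n := by exact_mod_cast hn
  have hterm : ∀ i, 6 / 25 * (‖α i‖ ^ 2 - 1 / (n : ℝ) ^ 2) ≤
      ‖α i‖ ^ 2 * (1 / 3) * ‖β i 0 + β i 1 + β i 2‖ ^ 2 := by
    intro i
    rcases le_or_gt (1 / (n : ℝ) ^ 2) (‖α i‖ ^ 2) with h | h
    · have hsum := hβ i
      rw [Fin.sum_univ_three] at hsum
      have hS : 18 / 25 ≤ ‖β i 0 + β i 1 + β i 2‖ ^ 2 := by
        obtain ⟨j, hj⟩ := hcolor i h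
        fin_cases j
        · exact norm_add_add_sq_ge hsum hj
        · rw [add_comm (β i 0)]
          exact norm_add_add_sq_ge (by linarith) hj
        · rw [add_comm _ (β i 2), ← add_assoc]
          exact norm_add_add_sq_ge (by linarith) hj
      have hpos : 0 ≤ 1 / (n : ℝ) ^ 2 := by positivity
      nlinarith [mul_le_mul_of_nonneg_left hS (sq_nonneg ‖α i‖)]
    · have hpos : 0 ≤ ‖α i‖ ^ 2 * (1 / 3) * ‖β i 0 + β i 1 + β i 2‖ ^ 2 := by positivity
      linarith
  have hinv : (n : ℝ) * (1 / (n : ℝ) ^ 2) ≤ 1 / 6 := by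
    calc (n : ℝ) * (1 / (n : ℝ) ^ 2) = 1 / n := by field_simp
      _ ≤ 1 / 6 := by gcongr
  calc (1 / 5 : ℝ) ≤ 6 / 25 * (1 - n * (1 / (n : ℝ) ^ 2)) := by linarith
    _ = ∑ i, 6 / 25 * (‖α i‖ ^ 2 - 1 / (n : ℝ) ^ 2) := by
      rw [← Finset.mul_sum, Finset.sum_sub_distrib, hα, Finset.sum_const, Finset.card_univ,
        Fintype.card_fin, nsmul_eq_mul]
    _ ≤ _ := Finset.sum_le_sum fun i _ => hterm i
end

section
/- Let n be a positive natural number and let γ : Fin n → ℂ be a unit vector in the ℓ² norm. If there exists l : Fin n with ‖γ l‖² ≤ 1/(2*n), then ‖∑ i, γ i * (1/Real.sqrt n)‖² ≤ 1 − 1/(16*n²); consequently the probability of not obtaining the uniform-superposition outcome F_n|0⟩ when γ is measured in the Fourier basis is at least 1/(16*n²). -/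
/-- A nonnegative unit vector with a coordinate of square at most `1 / (2n)` has squared overlap at
most `1 - 1 / (16n²)` with the normalized constant vector. -/
theorem sq_sum_div_sqrt_le_of_coord_sq_le {n : ℕ} (hn : 0 < n) {a : Fin n → ℝ}
    (ha0 : ∀ i, 0 ≤ a i) (ha : ∑ i, a i ^ 2 = 1) {l : Fin n}
    (hl : a l ^ 2 ≤ 1 / (2 * (n : ℝ))) :
    ((∑ i, a i) / √n) ^ 2 ≤ 1 - 1 / (16 * (n : ℝ) ^ 2) := by
  have hn1 : (1 : ℝ) ≤ n := by exact_mod_cast hn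
  have hs : 0 < √(n : ℝ) := Real.sqrt_pos.2 (by linarith)
  have hs2 : √(n : ℝ) ^ 2 = n := Real.sq_sqrt (by linarith)
  set s := √(n : ℝ)
  set p := (∑ i, a i) / s with hp
  have hS : ∑ i, a i = s * p := by rw [hp]; field_simp
  have hp0 : 0 ≤ p := div_nonneg (Finset.sum_nonneg fun i _ => ha0 i) hs.le
  have hvar : ∑ i, (s * a i - p) ^ 2 = n * (1 - p ^ 2) := by
    have hexp : ∀ i, (s * a i - p) ^ 2 = s ^ 2 * a i ^ 2 - 2 * s * p * a i + p ^ 2 :=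
      fun i => by ring
    simp only [hexp, Finset.sum_add_distrib, Finset.sum_sub_distrib, ← Finset.mul_sum, ha, hS,
      Finset.sum_const, Finset.card_univ, Fintype.card_fin, nsmul_eq_mul]
    linear_combination (1 - 2 * p ^ 2) * hs2
  have hle : (s * a l - p) ^ 2 ≤ n * (1 - p ^ 2) :=
    hvar ▸ Finset.single_le_sum (f := fun i => (s * a i - p) ^ 2)
      (fun i _ => sq_nonneg _) (Finset.mem_univ l)
  have hq : (s * a l) ^ 2 ≤ 1 / 2 := by
    rw [mul_pow, hs2]
    calc (n : ℝ) * a l ^ 2 ≤ n * (1 / (2 * n)) := by gcongr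
      _ = 1 / 2 := by field_simp
  by_contra! hlt
  have hgap : (n : ℝ) * (1 - p ^ 2) ≤ 1 / 16 := by
    calc (n : ℝ) * (1 - p ^ 2) ≤ n * (1 / (16 * (n : ℝ) ^ 2)) := by gcongr; linarith
      _ = 1 / (16 * (n : ℝ)) := by field_simp
      _ ≤ 1 / 16 := by gcongr; linarith
  have hp2 : 15 / 16 ≤ p ^ 2 := by nlinarith [sq_nonneg p, sq_nonneg (s * a l - p)]
  have hq1 : s * a l ≤ 71 / 100 := by nlinarith
  have hd : p - s * a l ≤ 1 / 4 := by nlinarith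
  nlinarith

/-- Lemma 6 (`lemma4`) of the paper: if a unit vector `γ : Fin n → ℂ` has some
coordinate `l` with `‖γ l‖² ≤ 1/(2n)`, then its overlap with the uniform
superposition `F_n|0⟩` satisfies `‖⟨u|γ⟩‖² ≤ 1 − 1/(16n²)`, so measuring `γ`
in the Fourier basis fails to yield `F_n|0⟩` with probability at least
`1/(16n²)`. -/
theorem fourier_test_fails (n : ℕ) (hn : 0 < n)
    (γ : Fin n → ℂ) (hγ : ∑ i, ‖γ i‖ ^ 2 = 1)
    (h : ∃ l : Fin n, ‖γ l‖ ^ 2 ≤ 1 / (2 * (n : ℝ))) :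
    ‖∑ i, γ i * (1 / (Real.sqrt n : ℂ))‖ ^ 2 ≤ 1 - 1 / (16 * (n : ℝ) ^ 2) ∧
      1 - ‖∑ i, γ i * (1 / (Real.sqrt n : ℂ))‖ ^ 2 ≥ 1 / (16 * (n : ℝ) ^ 2) := by
  obtain ⟨l, hl⟩ := h
  have hnorm : ‖∑ i, γ i * (1 / (Real.sqrt n : ℂ))‖ ≤ (∑ i, ‖γ i‖) / √n := by
    rw [← Finset.sum_mul, norm_mul, norm_div, norm_one, Complex.norm_real,
      Real.norm_of_nonneg (Real.sqrt_nonneg _), mul_one_div]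
    gcongr
    exact norm_sum_le _ _
  have hmain : ‖∑ i, γ i * (1 / (Real.sqrt n : ℂ))‖ ^ 2 ≤ 1 - 1 / (16 * (n : ℝ) ^ 2) :=
    (pow_le_pow_left₀ (norm_nonneg _) hnorm 2).trans
      (sq_sum_div_sqrt_le_of_coord_sq_le hn (fun i => norm_nonneg (γ i)) hγ hl)
  exact ⟨hmain, by linarith⟩
end

section
/- Let n be a positive natural number, let α : Fin n → ℂ, and let c : Fin n → ℂ with ‖c i‖ ≤ 1 for all i. Set P = ∑ j, ‖α j * c j‖² and assume P ≥ 1/5. If ‖∑ i, (α i * c i / Real.sqrt P) * (1/Real.sqrt n)‖² > 1 − 1/(16*n²), then for every i, ‖α i‖² ≥ 1/(10*n). -/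
/-- A coordinate of a real vector is bounded below in terms of the mean and the variance. -/
theorem sq_ge_of_mean_variance {ι : Type*} [Fintype ι] (y : ι → ℝ) (i : ι) :
    3 / 4 * ((∑ j, y j) / Fintype.card ι) ^ 2
      - 3 * (∑ j, y j ^ 2 - (∑ j, y j) ^ 2 / Fintype.card ι) ≤ y i ^ 2 := by
  have : Nonempty ι := ⟨i⟩
  have hn : (Fintype.card ι : ℝ) ≠ 0 := by exact_mod_cast Fintype.card_ne_zero
  set Y := ∑ j, y j with hY
  set m := Y / Fintype.card ι with hm
  have hvar : ∑ j, (y j - m) ^ 2 = ∑ j, y j ^ 2 - Y ^ 2 / Fintype.card ι := by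
    simp only [sub_sq, Finset.sum_add_distrib, Finset.sum_sub_distrib, ← Finset.sum_mul,
      ← Finset.mul_sum, ← hY, Finset.sum_const, Finset.card_univ, nsmul_eq_mul]
    rw [hm]
    field_simp
    ring
  have hi : (y i - m) ^ 2 ≤ ∑ j, (y j - m) ^ 2 :=
    Finset.single_le_sum (f := fun j => (y j - m) ^ 2) (fun j _ => sq_nonneg _)
      (Finset.mem_univ i)
  nlinarith [sq_nonneg (m / 2 + 2 * (y i - m))]

/-- Lemma 7 (`lemma5`) of the paper: if the probability `P` of obtaining
`F₃|0⟩` on the color register is at least `1/5`, and the normalized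
post-measurement node state `γ i = α i * c i / √P` has overlap with the
uniform superposition greater than `1 − 1/(16n²)`, then every node amplitude
satisfies `‖α i‖² ≥ 1/(10n)`. -/
theorem all_nodes_present (n : ℕ) (hn : 0 < n)
    (α : Fin n → ℂ) (c : Fin n → ℂ) (hc : ∀ i, ‖c i‖ ≤ 1)
    (P : ℝ) (hP : P = ∑ j, ‖α j * c j‖ ^ 2) (hP5 : P ≥ 1 / 5)
    (hover : ‖∑ i, (α i * c i / (Real.sqrt P : ℂ)) * (1 / (Real.sqrt n : ℂ))‖ ^ 2 >
      1 - 1 / (16 * (n : ℝ) ^ 2)) :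
    ∀ i : Fin n, ‖α i‖ ^ 2 ≥ 1 / (10 * (n : ℝ)) := by
  intro i
  have hn1 : (1 : ℝ) ≤ n := by exact_mod_cast hn
  have hn0 : (0 : ℝ) < n := by linarith
  have hP0 : 0 < P := by linarith
  have hfactor : ∑ i, (α i * c i / (Real.sqrt P : ℂ)) * (1 / (Real.sqrt n : ℂ))
      = (∑ i, α i * c i) / ((Real.sqrt P : ℂ) * (Real.sqrt n : ℂ)) := by
    rw [Finset.sum_div]
    exact Finset.sum_congr rfl fun j _ => by rw [div_mul_div_comm, mul_one]
  rw [hfactor, norm_div, norm_mul, Complex.norm_real, Complex.norm_real, div_pow, mul_pow,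
    Real.norm_eq_abs, Real.norm_eq_abs, sq_abs, sq_abs, Real.sq_sqrt hP0.le,
    Real.sq_sqrt hn0.le, gt_iff_lt, lt_div_iff₀ (by positivity)] at hover
  have htri : ‖∑ j, α j * c j‖ ^ 2 ≤ (∑ j, ‖α j * c j‖) ^ 2 := by
    gcongr
    exact norm_sum_le _ _
  have hcoord := sq_ge_of_mean_variance (fun j => ‖α j * c j‖) i
  simp only [Fintype.card_fin, ← hP] at hcoord
  have hα : ‖α i * c i‖ ^ 2 ≤ ‖α i‖ ^ 2 := by
    rw [norm_mul]
    gcongr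
    exact mul_le_of_le_one_right (norm_nonneg _) (hc i)
  set Y := ∑ j, ‖α j * c j‖
  obtain ⟨t, ht⟩ : ∃ t : ℝ, t = 1 / n := ⟨_, rfl⟩
  have ht0 : 0 < t := by rw [ht]; positivity
  have ht1 : t ≤ 1 := by rw [ht]; exact (div_le_one hn0).2 hn1
  have hQ : P * (1 - t ^ 2 / 16) ≤ Y ^ 2 * t := by
    have h := mul_le_mul_of_nonneg_right (hover.le.trans htri) ht0.le
    refine le_trans (le_of_eq ?_) h
    rw [ht]
    field_simp
  have hcoord' : 3 / 4 * (Y ^ 2 * t) * t - 3 * (P - Y ^ 2 * t) ≤ ‖α i * c i‖ ^ 2 := by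
    refine le_trans (le_of_eq ?_) hcoord
    rw [ht]
    field_simp
  have hQt := mul_le_mul_of_nonneg_right hQ ht0.le
  have hpoly : P * (t / 2) ≤ 3 / 4 * (P * (1 - t ^ 2 / 16) * t) - 3 * (P * (t ^ 2 / 16)) := by
    have h : t / 2 ≤ 3 / 4 * ((1 - t ^ 2 / 16) * t) - 3 * (t ^ 2 / 16) := by
      nlinarith [mul_nonneg ht0.le (sub_nonneg.2 ht1),
        mul_nonneg (sq_nonneg t) (sub_nonneg.2 ht1)]
    nlinarith [mul_le_mul_of_nonneg_left h hP0.le]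
  have hgoal : 1 / (10 * (n : ℝ)) = 1 / 5 * (t / 2) := by
    rw [ht]
    field_simp
    norm_num
  rw [hgoal]
  nlinarith [mul_le_mul_of_nonneg_right hP5 (half_pos ht0).le]
end

section
/- Let n be a positive natural number, let G be a simple graph on Fin n, and let C : Fin n → Fin 3 be a proper 3-coloring of G (i.e. G.Adj i i' → C i ≠ C i'). Define ψ : Fin n × Fin 3 → ℂ by ψ (i,j) = 1/Real.sqrt n if j = C i and 0 otherwise. Then: (a) ∑ p, ‖ψ p‖² = 1; (b) ‖∑ p, conj (ψ p) * ψ p‖² = 1 (so the swap test on two copies of ψ succeeds with probability 1); (c) ∑ i, ∑ over pairs j ≠ j', ‖ψ (i,j)‖² * ‖ψ (i,j')‖² = 0 and ∑ over ordered pairs (i,i') with G.Adj i i', ∑ j, ‖ψ (i,j)‖² * ‖ψ (i',j)‖² = 0 (Test 2 never fails); (d) with v j = (1/Real.sqrt 3) * (ψ (j,0) + ψ (j,1) + ψ (j,2)) and u j = 1/Real.sqrt n, one has (∑ j, ‖v j‖²) − ‖∑ j, conj (u j) * v j‖² = 0 (Test 3 never fails). -/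
open scoped ComplexConjugate

/-- Lemma 2 (`completeness-thm`) of the paper: for a proper 3-coloring `C` of
the graph `G`, the honest proof `ψ = (1/√n) ∑ i |i⟩|C(i)⟩` (supplied in both
registers) passes all three tests of the verifier with probability 1:
(a) `ψ` is a unit vector; (b) the swap test succeeds with probability 1;
(c) Test 2 (color consistency on equal nodes, and distinct colors on edges)
never fails; (d) Test 3 (Fourier measurement of color then node registers)
never fails. -/
theorem honest_proof_accepted (n : ℕ) (hn : 0 < n)
    (G : SimpleGraph (Fin n)) [DecidableRel G.Adj] (C : Fin n → Fin 3)
    (hC : ∀ i i' : Fin n, G.Adj i i' → C i ≠ C i')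
    (ψ : Fin n × Fin 3 → ℂ)
    (hψ : ∀ i j, ψ (i, j) = if j = C i then (1 / (Real.sqrt n : ℂ)) else 0) :
    (∑ p, ‖ψ p‖ ^ 2 = 1) ∧
    (‖∑ p, conj (ψ p) * ψ p‖ ^ 2 = 1) ∧
    ((∑ i : Fin n, ∑ j : Fin 3, ∑ j' : Fin 3,
        if j ≠ j' then ‖ψ (i, j)‖ ^ 2 * ‖ψ (i, j')‖ ^ 2 else 0) = 0 ∧
      (∑ i : Fin n, ∑ i' : Fin n,
        if G.Adj i i' then ∑ j : Fin 3, ‖ψ (i, j)‖ ^ 2 * ‖ψ (i', j)‖ ^ 2 else 0) = 0) ∧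
    (∀ (v u : Fin n → ℂ),
      (∀ j, v j = (1 / (Real.sqrt 3 : ℂ)) * (ψ (j, 0) + ψ (j, 1) + ψ (j, 2))) →
      (∀ j, u j = 1 / (Real.sqrt n : ℂ)) →
      (∑ j, ‖v j‖ ^ 2) - ‖∑ j, conj (u j) * v j‖ ^ 2 = 0) := by
  have hn' : (n : ℝ) ≠ 0 := by positivity
  have hs : ((Real.sqrt n : ℝ) : ℂ) * (Real.sqrt n : ℂ) = n := by
    rw [← Complex.ofReal_mul, Real.mul_self_sqrt n.cast_nonneg, Complex.ofReal_natCast]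
  have hnormSq : ∀ i j, ‖ψ (i, j)‖ ^ 2 = if j = C i then (1 / n : ℝ) else 0 := by
    intro i j
    rw [hψ]
    split_ifs
    · rw [norm_div, norm_one, Complex.norm_real, div_pow, Real.norm_eq_abs, sq_abs,
        Real.sq_sqrt n.cast_nonneg, one_pow]
    · simp
  have hunit : ∑ p, ‖ψ p‖ ^ 2 = 1 := by
    simp [Fintype.sum_prod_type, hnormSq, hn']
  refine ⟨hunit, ?_, ⟨?_, ?_⟩, ?_⟩
  · have hinner : ∑ p, conj (ψ p) * ψ p = 1 := by
      simp_rw [Complex.conj_mul']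
      exact_mod_cast hunit
    simp [hinner]
  · refine Finset.sum_eq_zero fun i _ => Finset.sum_eq_zero fun j _ =>
      Finset.sum_eq_zero fun j' _ => ?_
    simp only [hnormSq]
    split_ifs <;> simp_all
  · refine Finset.sum_eq_zero fun i _ => Finset.sum_eq_zero fun i' _ => ?_
    split_ifs with hadj
    · refine Finset.sum_eq_zero fun j _ => ?_
      simp only [hnormSq]
      split_ifs with h h'
      · exact absurd (h.symm.trans h') (hC i i' hadj)
      all_goals simp
    · rfl
  · intro v u hv hu
    have hv' : ∀ j, v j = 1 / (Real.sqrt 3 : ℂ) * (1 / (Real.sqrt n : ℂ)) := by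
      intro j
      rw [hv, ← Fin.sum_univ_three fun k => ψ (j, k)]
      simp [hψ]
    have hnorm : ∀ j, ‖v j‖ ^ 2 = 1 / 3 * (1 / n : ℝ) := by
      intro j
      rw [hv', norm_mul, mul_pow]
      simp [Complex.norm_real, sq_abs]
    have hinner : ∑ j, conj (u j) * v j = 1 / (Real.sqrt 3 : ℂ) := by
      have hnC : (n : ℂ) ≠ 0 := by exact_mod_cast hn.ne'
      have hsn : (Real.sqrt n : ℂ) ≠ 0 := fun h => hnC (by rw [← hs, h, zero_mul])
      simp only [hu, hv', map_div₀, map_one, Complex.conj_ofReal, Finset.sum_const,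
        Finset.card_univ, Fintype.card_fin, nsmul_eq_mul]
      rw [← hs]
      field_simp
    rw [hinner, Finset.sum_congr rfl fun j _ => hnorm j]
    simp [Complex.norm_real, sq_abs]
    field_simp
    simp
end
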